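/- arXiv:2412.06848 — 2 statements merged into one kernel-verified Lean document; each statement's English description precedes it below -/
import Mathlib

section
/- There exists a constant c > 0 such that for every positive integer m, sup_{x∈ℝ} | Φ( √(m/2) ( e^{√(2/m)·x} − 1 ) ) − Φ(x) | ≤ c/√m. -/
open MeasureTheory ProbabilityTheory

/-- Standard normal cumulative distribution function. -/
noncomputable def stdNormalCDF (x : ℝ) : ℝ :=
  ((gaussianReal 0 1) (Set.Iic x)).toReal

theorem gaussianPDFReal_zero_one_le_inv_sq {t : ℝ} (ht : t ≠ 0) :
    gaussianPDFReal 0 1 t ≤ (t ^ 2)⁻¹ := by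
  have ht2 : 0 < t ^ 2 := by positivity
  have hpi : (2 : ℝ) ≤ Real.sqrt (2 * Real.pi) :=
    Real.le_sqrt_of_sq_le (by nlinarith [Real.pi_gt_three])
  have hexp : t ^ 2 / 2 ≤ Real.exp (t ^ 2 / 2) := by
    linarith [Real.add_one_le_exp (t ^ 2 / 2)]
  have h : gaussianPDFReal 0 1 t = (Real.sqrt (2 * Real.pi) * Real.exp (t ^ 2 / 2))⁻¹ := by
    simp [gaussianPDFReal, neg_div, Real.exp_neg, mul_comm]
  rw [h]
  apply inv_anti₀ ht2
  nlinarith [mul_le_mul hpi hexp (by positivity) (by positivity)]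

theorem stdNormalCDF_sub_le_inv_sub_inv {x y : ℝ} (hxy : x ≤ y) (h0 : 0 ∉ Set.Icc x y) :
    stdNormalCDF y - stdNormalCDF x ≤ x⁻¹ - y⁻¹ := by
  have hne : ∀ t ∈ Set.Icc x y, t ≠ 0 := fun t ht h => h0 (h ▸ ht)
  have hcdf : stdNormalCDF y - stdNormalCDF x = ∫ t in x..y, gaussianPDFReal 0 1 t := by
    have hΦ : ∀ z, stdNormalCDF z = ∫ t in Set.Iic z, gaussianPDFReal 0 1 t := fun z => by
      rw [stdNormalCDF, gaussianReal_apply_eq_integral 0 one_ne_zero, ENNReal.toReal_ofReal]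
      exact setIntegral_nonneg measurableSet_Iic fun t _ => gaussianPDFReal_nonneg 0 1 t
    rw [hΦ, hΦ]
    exact intervalIntegral.integral_Iic_sub_Iic
      (integrable_gaussianPDFReal 0 1).integrableOn (integrable_gaussianPDFReal 0 1).integrableOn
  have hint : IntervalIntegrable (fun t : ℝ => (t ^ 2)⁻¹) volume x y := by
    apply ContinuousOn.intervalIntegrable
    rw [Set.uIcc_of_le hxy]
    exact (continuousOn_pow 2).inv₀ fun t ht => pow_ne_zero 2 (hne t ht)
  have hinv : ∫ t in x..y, (t ^ 2)⁻¹ = x⁻¹ - y⁻¹ := by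
    have h := intervalIntegral.integral_eq_sub_of_hasDerivAt (f := fun t : ℝ => -t⁻¹)
      (f' := fun t => (t ^ 2)⁻¹) (a := x) (b := y) (fun t ht => by
        rw [Set.uIcc_of_le hxy] at ht
        simpa using (hasDerivAt_inv (hne t ht)).fun_neg) hint
    rw [h]
    ring
  rw [hcdf, ← hinv]
  exact intervalIntegral.integral_mono_on hxy
    (integrable_gaussianPDFReal 0 1).intervalIntegrable hint
    fun t ht => gaussianPDFReal_zero_one_le_inv_sq (hne t ht)

theorem inv_sub_inv_exp_sub_one_le_one {u : ℝ} (hu : u ≠ 0) :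
    u⁻¹ - (Real.exp u - 1)⁻¹ ≤ 1 := by
  have hpos : 0 < u * (Real.exp u - 1) := by
    rcases hu.lt_or_gt with h | h
    · exact mul_pos_of_neg_of_neg h (by linarith [Real.exp_lt_one_iff.2 h])
    · exact mul_pos h (by linarith [Real.add_one_le_exp u])
  have hE : Real.exp u - 1 ≠ 0 := right_ne_zero_of_mul hpos.ne'
  have key : Real.exp u * (1 - u) ≤ 1 := by
    have h := mul_le_mul_of_nonneg_left (Real.add_one_le_exp (-u)) (Real.exp_pos u).le
    rw [← Real.exp_add, add_neg_cancel, Real.exp_zero] at h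
    linarith
  rw [inv_sub_inv hu hE, div_le_one hpos]
  linarith

theorem abs_stdNormalCDF_exp_sub_one_div_sub_le {a : ℝ} (ha : 0 < a) (x : ℝ) :
    |stdNormalCDF (a⁻¹ * (Real.exp (a * x) - 1)) - stdNormalCDF x| ≤ a := by
  rcases eq_or_ne x 0 with rfl | hx
  · simpa using ha.le
  have hxy : x ≤ a⁻¹ * (Real.exp (a * x) - 1) := by
    rw [le_inv_mul_iff₀ ha]
    linarith [Real.add_one_le_exp (a * x)]
  have h0 : 0 ∉ Set.Icc x (a⁻¹ * (Real.exp (a * x) - 1)) := by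
    rintro ⟨hx0, hy0⟩
    have hexp : Real.exp (a * x) < 1 :=
      Real.exp_lt_one_iff.2 (mul_neg_of_pos_of_neg ha (hx0.lt_of_ne hx))
    have : a⁻¹ * (Real.exp (a * x) - 1) < 0 :=
      mul_neg_of_pos_of_neg (inv_pos.2 ha) (by linarith)
    linarith
  have hmono : stdNormalCDF x ≤ stdNormalCDF (a⁻¹ * (Real.exp (a * x) - 1)) :=
    measureReal_mono (Set.Iic_subset_Iic.2 hxy)
  rw [abs_of_nonneg (sub_nonneg.2 hmono)]
  refine (stdNormalCDF_sub_le_inv_sub_inv hxy h0).trans ?_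
  have h := mul_le_mul_of_nonneg_left
    (inv_sub_inv_exp_sub_one_le_one (mul_ne_zero ha.ne' hx)) ha.le
  calc x⁻¹ - (a⁻¹ * (Real.exp (a * x) - 1))⁻¹
      = a * ((a * x)⁻¹ - (Real.exp (a * x) - 1)⁻¹) := by
        rw [mul_inv, mul_inv, inv_inv, mul_sub, mul_inv_cancel_left₀ ha.ne']
    _ ≤ a := by simpa using h

/-- There exists `c > 0` such that for every positive integer `m`,
`sup_x |Φ(√(m/2)(e^{√(2/m)·x} − 1)) − Φ(x)| ≤ c/√m`. -/
theorem stmt2 :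
    ∃ c : ℝ, 0 < c ∧
      ∀ m : ℕ, 0 < m →
        ∀ x : ℝ,
          |stdNormalCDF (Real.sqrt ((m : ℝ) / 2) * (Real.exp (Real.sqrt (2 / (m : ℝ)) * x) - 1))
              - stdNormalCDF x|
            ≤ c / Real.sqrt m := by
  refine ⟨Real.sqrt 2, by positivity, fun m hm x => ?_⟩
  have hm' : (0 : ℝ) < m := Nat.cast_pos.2 hm
  have h := abs_stdNormalCDF_exp_sub_one_div_sub_le (a := Real.sqrt (2 / m)) (by positivity) x
  rw [← Real.sqrt_inv, inv_div] at h
  rwa [← Real.sqrt_div zero_le_two]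
end

section
/- (Berry–Esseen type bound for the logarithm of a chi-square random variable.) There exists a constant c > 0 such that for every positive integer m the following holds: if Z_m is a random variable with the chi-square distribution with m degrees of freedom, then sup_{x∈ℝ} | P( √(m/2) · log(Z_m/m) ≤ x ) − Φ(x) | ≤ c/√m. -/
open MeasureTheory ProbabilityTheory

/-- The chi-square distribution with `m` degrees of freedom, i.e. the Gamma distribution
with shape `m/2` and rate `1/2`. -/
noncomputable def chiSquareMeasure (m : ℕ) : Measure ℝ :=
  gammaMeasure ((m : ℝ) / 2) (1 / 2)

lemma abs_exp_neg_sub_exp_neg_le {A B m : ℝ} (hA : m ≤ A) (hB : m ≤ B) :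
    |Real.exp (-A) - Real.exp (-B)| ≤ |A - B| * Real.exp (-m) := by
  wlog h : A ≤ B generalizing A B
  · rw [abs_sub_comm, abs_sub_comm A B]
    exact this hB hA (le_of_not_ge h)
  rw [abs_of_nonneg (sub_nonneg.2 (Real.exp_le_exp.2 (neg_le_neg h))), abs_of_nonpos (by linarith)]
  have h1 : Real.exp (-B) = Real.exp (-A) * Real.exp (A - B) := by
    rw [← Real.exp_add]; ring_nf
  have h2 := Real.add_one_le_exp (A - B)
  calc Real.exp (-A) - Real.exp (-B) = Real.exp (-A) * (1 - Real.exp (A - B)) := by rw [h1]; ring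
    _ ≤ Real.exp (-A) * (B - A) :=
      mul_le_mul_of_nonneg_left (by linarith) (Real.exp_pos _).le
    _ ≤ Real.exp (-m) * (B - A) := by
      have : 0 ≤ B - A := by linarith
      gcongr
    _ = _ := by ring

lemma abs_exp_sub_quadratic_le {t : ℝ} (ht : |t| ≤ 1) :
    |Real.exp t - 1 - t - t ^ 2 / 2| ≤ 2 / 9 * |t| ^ 3 := by
  have h := Real.exp_bound ht (n := 3) (by norm_num)
  simp only [Finset.sum_range_succ, Finset.sum_range_zero, Nat.factorial] at h
  norm_num at h
  convert h using 1
  · congr 1; ring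
  · ring

lemma sq_div_four_le_exp_sub {t : ℝ} (ht : |t| ≤ 1) : t ^ 2 / 4 ≤ Real.exp t - 1 - t := by
  have h := (abs_le.1 (abs_exp_sub_quadratic_le ht)).1
  have h3 : |t| ^ 3 ≤ t ^ 2 := by
    rw [← sq_abs t]
    exact pow_le_pow_of_le_one (abs_nonneg t) ht (by norm_num)
  linarith [sq_nonneg t]

lemma abs_div_four_le_exp_sub {t : ℝ} (ht : 1 < |t|) : |t| / 4 ≤ Real.exp t - 1 - t := by
  rcases lt_abs.1 ht with h | h
  · rw [abs_of_pos (by linarith)]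
    nlinarith [Real.quadratic_le_exp_of_nonneg (by linarith : 0 ≤ t)]
  · rw [abs_of_neg (by linarith)]
    have h1 : Real.exp t = Real.exp (-1) * Real.exp (t + 1) := by
      rw [← Real.exp_add]; ring_nf
    have h2 := Real.add_one_le_exp (t + 1)
    have h3 := Real.exp_neg_one_gt_d9
    have h4 := Real.exp_neg_one_lt_d9
    nlinarith

lemma one_add_pow_three_mul_exp_neg_le {u k : ℝ} (hu : 0 ≤ u) (hk : 1 ≤ k) :
    (1 + u) ^ 3 * Real.exp (-(3 * (u / k))) ≤ k ^ 3 := by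
  have hk0 : 0 < k := by linarith
  have h1 : 1 + u ≤ k * Real.exp (u / k) := by
    calc 1 + u ≤ k * (u / k + 1) := by rw [mul_add, mul_div_cancel₀ _ hk0.ne']; linarith
      _ ≤ _ := by gcongr; exact Real.add_one_le_exp _
  calc (1 + u) ^ 3 * Real.exp (-(3 * (u / k)))
      ≤ (k * Real.exp (u / k)) ^ 3 * Real.exp (-(3 * (u / k))) := by gcongr
    _ = k ^ 3 * Real.exp (3 * (u / k) + -(3 * (u / k))) := by
      rw [mul_pow, ← Real.exp_nat_mul, mul_assoc, ← Real.exp_add]; norm_num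
    _ = k ^ 3 := by simp

/-- The density, up to normalization, of `s * log (Z / (2 * s ^ 2))` for `Z` Gamma distributed with
shape `s ^ 2` and rate `1 / 2`. -/
noncomputable def logGammaKernel (s y : ℝ) : ℝ :=
  Real.exp (-(s ^ 2 * (Real.exp (y / s) - 1 - y / s)))

lemma abs_logGammaKernel_sub_le {s : ℝ} (hs : 1 / 2 ≤ s) (y : ℝ) :
    |logGammaKernel s y - Real.exp (-(y ^ 2 / 2))| ≤ 24 ^ 3 / s * (1 + y ^ 2)⁻¹ := by
  have hs0 : 0 < s := by linarith
  obtain ⟨t, rfl⟩ : ∃ t, y = s * t := ⟨y / s, by field_simp⟩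
  rw [logGammaKernel, mul_div_cancel_left₀ _ hs0.ne', ← div_eq_mul_inv, le_div_iff₀ (by positivity),
    le_div_iff₀ hs0]
  rcases le_or_gt |t| 1 with ht | ht
  · have h1 := abs_exp_neg_sub_exp_neg_le (A := s ^ 2 * (Real.exp t - 1 - t))
      (B := (s * t) ^ 2 / 2) (m := (s * t) ^ 2 / 4)
      (by nlinarith [sq_div_four_le_exp_sub ht, sq_nonneg s]) (by nlinarith [sq_nonneg (s * t)])
    have h2 : |s ^ 2 * (Real.exp t - 1 - t) - (s * t) ^ 2 / 2| * s ≤ |s * t| ^ 3 := by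
      have : s ^ 2 * (Real.exp t - 1 - t) - (s * t) ^ 2 / 2
          = s ^ 2 * (Real.exp t - 1 - t - t ^ 2 / 2) := by ring
      rw [this, abs_mul, abs_mul, abs_of_pos (pow_pos hs0 2), abs_of_pos hs0]
      calc s ^ 2 * |Real.exp t - 1 - t - t ^ 2 / 2| * s ≤ s ^ 2 * (1 * |t| ^ 3) * s := by
            gcongr
            exact (abs_exp_sub_quadratic_le ht).trans (by gcongr; norm_num)
        _ = _ := by ring
    generalize s * t = y at *
    have h3 : |y| ^ 3 ≤ (1 + y ^ 2) ^ 2 := by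
      rw [← sq_abs y]
      have := abs_nonneg y
      nlinarith [sq_nonneg (|y| - 1), sq_nonneg (|y| ^ 2 - |y|), pow_nonneg this 3]
    have h4 := one_add_pow_three_mul_exp_neg_le (sq_nonneg y) (by norm_num : (1 : ℝ) ≤ 12)
    have h5 : -(3 * (y ^ 2 / 12)) = -(y ^ 2 / 4) := by ring
    rw [h5] at h4
    set e := Real.exp (-(y ^ 2 / 4)) with he
    have he0 : 0 < e := Real.exp_pos _
    calc _ ≤ |s ^ 2 * (Real.exp t - 1 - t) - y ^ 2 / 2| * e * (1 + y ^ 2) * s := by gcongr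
      _ = |s ^ 2 * (Real.exp t - 1 - t) - y ^ 2 / 2| * s * (e * (1 + y ^ 2)) := by ring
      _ ≤ (1 + y ^ 2) ^ 2 * (e * (1 + y ^ 2)) := by gcongr; exact h2.trans h3
      _ = (1 + y ^ 2) ^ 3 * e := by ring
      _ ≤ 24 ^ 3 := h4.trans (by norm_num)
  · have hy : |s * t| = s * |t| := by rw [abs_mul, abs_of_pos hs0]
    have hst : s ≤ |s * t| := by rw [hy]; nlinarith
    have h1 : |s * t| / 8 ≤ s ^ 2 * (Real.exp t - 1 - t) := by
      calc |s * t| / 8 ≤ s ^ 2 * (|t| / 4) := by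
            rw [hy]
            nlinarith [mul_pos hs0 (by linarith : 0 < |t|)]
        _ ≤ _ := by gcongr; exact abs_div_four_le_exp_sub ht
    have h2 : |s * t| / 8 ≤ (s * t) ^ 2 / 2 := by
      rw [← sq_abs (s * t)]; nlinarith
    generalize s * t = y at *
    have h3 : |Real.exp (-(s ^ 2 * (Real.exp t - 1 - t))) - Real.exp (-(y ^ 2 / 2))|
        ≤ Real.exp (-(|y| / 8)) := by
      have h5 : Real.exp (-(s ^ 2 * (Real.exp t - 1 - t))) ≤ Real.exp (-(|y| / 8)) :=
        Real.exp_le_exp.2 (by linarith)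
      have h6 : Real.exp (-(y ^ 2 / 2)) ≤ Real.exp (-(|y| / 8)) :=
        Real.exp_le_exp.2 (by linarith)
      rw [abs_le]
      constructor <;> linarith [Real.exp_pos (-(s ^ 2 * (Real.exp t - 1 - t))),
        Real.exp_pos (-(y ^ 2 / 2))]
    have h4 := one_add_pow_three_mul_exp_neg_le (abs_nonneg y) (by norm_num : (1 : ℝ) ≤ 24)
    have h5 : -(3 * (|y| / 24)) = -(|y| / 8) := by ring
    rw [h5] at h4
    have h6 : (1 + y ^ 2) * |y| ≤ (1 + |y|) ^ 3 := by
      rw [← sq_abs y]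
      nlinarith [abs_nonneg y, sq_nonneg |y|]
    calc _ ≤ Real.exp (-(|y| / 8)) * (1 + y ^ 2) * |y| := by gcongr
      _ = (1 + y ^ 2) * |y| * Real.exp (-(|y| / 8)) := by ring
      _ ≤ (1 + |y|) ^ 3 * Real.exp (-(|y| / 8)) := by gcongr
      _ ≤ _ := h4

lemma abs_normalized_setIntegral_sub_le {α : Type*} [MeasurableSpace α] {μ : Measure α}
    {f g : α → ℝ} {a b : ℝ} (hf : Integrable f μ) (hg : Integrable g μ) (hf0 : 0 ≤ f)
    (hb : 0 ≤ b) (hfa : a * ∫ x, f x ∂μ = 1) (hgb : b * ∫ x, g x ∂μ = 1) (S : Set α) :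
    |a * ∫ x in S, f x ∂μ - b * ∫ x in S, g x ∂μ| ≤ 2 * b * ∫ x, |f x - g x| ∂μ := by
  have hfS : ∫ x in S, f x ∂μ ≤ ∫ x, f x ∂μ := setIntegral_le_integral hf (ae_of_all _ hf0)
  have hfS0 : 0 ≤ ∫ x in S, f x ∂μ := integral_nonneg hf0
  have h1 : |∫ x in S, f x ∂μ - ∫ x in S, g x ∂μ| ≤ ∫ x, |f x - g x| ∂μ := by
    rw [← integral_sub hf.integrableOn hg.integrableOn]
    exact abs_integral_le_integral_abs.trans
      (setIntegral_le_integral (hf.sub hg).abs (ae_of_all _ fun _ ↦ abs_nonneg _))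
  have h2 : |∫ x, g x ∂μ - ∫ x, f x ∂μ| ≤ ∫ x, |f x - g x| ∂μ := by
    rw [abs_sub_comm, ← integral_sub hf hg]
    exact abs_integral_le_integral_abs
  have h3 : |a - b| * ∫ x in S, f x ∂μ ≤ b * ∫ x, |f x - g x| ∂μ := by
    calc |a - b| * ∫ x in S, f x ∂μ ≤ |a - b| * ∫ x, f x ∂μ := by gcongr
      _ = |b * (∫ x, g x ∂μ - ∫ x, f x ∂μ)| := by
        rw [← abs_of_nonneg (integral_nonneg hf0), ← abs_mul, abs_of_nonneg (integral_nonneg hf0)]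
        congr 1
        linear_combination hfa - hgb
      _ ≤ _ := by rw [abs_mul, abs_of_nonneg hb]; gcongr
  calc |a * ∫ x in S, f x ∂μ - b * ∫ x in S, g x ∂μ|
      = |b * (∫ x in S, f x ∂μ - ∫ x in S, g x ∂μ) + (a - b) * ∫ x in S, f x ∂μ| := by
        congr 1; ring
    _ ≤ |b * (∫ x in S, f x ∂μ - ∫ x in S, g x ∂μ)| + |(a - b) * ∫ x in S, f x ∂μ| :=
        abs_add_le _ _
    _ ≤ b * ∫ x, |f x - g x| ∂μ + b * ∫ x, |f x - g x| ∂μ := by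
        rw [abs_mul, abs_mul, abs_of_nonneg hb, abs_of_nonneg hfS0]
        gcongr
    _ = _ := by ring

lemma continuous_logGammaKernel (s : ℝ) : Continuous (logGammaKernel s) := by
  unfold logGammaKernel
  fun_prop

/-- The normalizing constant of `logGammaKernel`. -/
noncomputable def logGammaConst (s : ℝ) : ℝ :=
  (1 / 2) ^ (s ^ 2) / Real.Gamma (s ^ 2) * (2 * s ^ 2) ^ (s ^ 2 - 1) * (2 * s) * Real.exp (-(s ^ 2))

lemma logGammaConst_nonneg {s : ℝ} (hs : 0 < s) : 0 ≤ logGammaConst s := by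
  unfold logGammaConst
  positivity

lemma deriv_mul_gammaPDFReal_eq {s : ℝ} (hs : 0 < s) (y : ℝ) :
    2 * s * Real.exp (y / s) * gammaPDFReal (s ^ 2) (1 / 2) (2 * s ^ 2 * Real.exp (y / s))
      = logGammaConst s * logGammaKernel s y := by
  have h0 : 0 ≤ 2 * s ^ 2 * Real.exp (y / s) := by positivity
  rw [gammaPDFReal, if_pos h0, Real.mul_rpow (by positivity) (Real.exp_pos _).le, ← Real.exp_mul,
    logGammaConst, logGammaKernel]
  have h1 : Real.exp (y / s) * Real.exp (y / s * (s ^ 2 - 1))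
        * Real.exp (-(1 / 2 * (2 * s ^ 2 * Real.exp (y / s))))
      = Real.exp (-(s ^ 2)) * Real.exp (-(s ^ 2 * (Real.exp (y / s) - 1 - y / s))) := by
    rw [← Real.exp_add, ← Real.exp_add, ← Real.exp_add]
    ring_nf
  linear_combination (2 * s * ((1 / 2) ^ (s ^ 2) / Real.Gamma (s ^ 2))
    * (2 * s ^ 2) ^ (s ^ 2 - 1)) * h1

lemma gammaMeasure_image_exp {s : ℝ} (hs : 0 < s) {S : Set ℝ} (hS : MeasurableSet S) :
    gammaMeasure (s ^ 2) (1 / 2) ((fun y ↦ 2 * s ^ 2 * Real.exp (y / s)) '' S)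
      = ∫⁻ y in S, ENNReal.ofReal (logGammaConst s * logGammaKernel s y) := by
  have hd (y : ℝ) : HasDerivAt (fun y ↦ 2 * s ^ 2 * Real.exp (y / s))
      (2 * s * Real.exp (y / s)) y := by
    refine ((((hasDerivAt_id' y).div_const s).exp).const_mul (2 * s ^ 2)).congr_deriv ?_
    field_simp
  have hinj : Function.Injective (fun y ↦ 2 * s ^ 2 * Real.exp (y / s)) := fun y z h ↦ by
    have h1 := Real.exp_injective (mul_left_cancel₀ (by positivity) h)
    exact (div_left_inj' hs.ne').1 h1
  rw [gammaMeasure, withDensity_apply',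
    lintegral_image_eq_lintegral_abs_deriv_mul hS (fun y _ ↦ (hd y).hasDerivWithinAt) hinj.injOn]
  refine lintegral_congr fun y ↦ ?_
  rw [gammaPDF, ← ENNReal.ofReal_mul (abs_nonneg _), abs_of_pos (by positivity),
    deriv_mul_gammaPDFReal_eq hs]

lemma gammaMeasure_Iic_zero (a r : ℝ) : gammaMeasure a r (Set.Iic 0) = 0 := by
  rw [gammaMeasure, withDensity_apply', setLIntegral_congr Iio_ae_eq_Iic.symm,
    lintegral_gammaPDF_of_nonpos le_rfl]

lemma gammaMeasure_log_le {s : ℝ} (hs : 0 < s) (x : ℝ) :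
    gammaMeasure (s ^ 2) (1 / 2) {z | s * Real.log (z / (2 * s ^ 2)) ≤ x}
      = ∫⁻ y in Set.Iic x, ENNReal.ofReal (logGammaConst s * logGammaKernel s y) := by
  rw [← gammaMeasure_image_exp hs measurableSet_Iic]
  have h0 : ∀ᵐ z ∂gammaMeasure (s ^ 2) (1 / 2), 0 < z := by
    rw [ae_iff]
    simp only [not_lt]
    exact gammaMeasure_Iic_zero (s ^ 2) (1 / 2)
  refine measure_congr ?_
  filter_upwards [h0] with z hz
  refine propext ⟨fun h ↦ ⟨s * Real.log (z / (2 * s ^ 2)), h, ?_⟩, ?_⟩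
  · simp only
    rw [mul_div_cancel_left₀ _ hs.ne', Real.exp_log (by positivity)]
    field_simp
  · rintro ⟨y, hy, rfl⟩
    change s * Real.log (2 * s ^ 2 * Real.exp (y / s) / (2 * s ^ 2)) ≤ x
    rw [mul_div_cancel_left₀ _ (by positivity), Real.log_exp, mul_div_cancel₀ _ hs.ne']
    exact hy

lemma lintegral_logGammaKernel {s : ℝ} (hs : 0 < s) :
    ∫⁻ y, ENNReal.ofReal (logGammaConst s * logGammaKernel s y) = 1 := by
  have := isProbabilityMeasure_gammaMeasure (pow_pos hs 2) (one_half_pos (α := ℝ))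
  rw [← setLIntegral_univ, ← gammaMeasure_image_exp hs MeasurableSet.univ, Set.image_univ]
  refine le_antisymm prob_le_one ?_
  have h : Set.univ ⊆ Set.Iic 0 ∪ Set.range (fun y ↦ 2 * s ^ 2 * Real.exp (y / s)) := by
    intro z _
    rcases le_or_gt z 0 with hz | hz
    · exact Or.inl hz
    · refine Or.inr ⟨s * Real.log (z / (2 * s ^ 2)), ?_⟩
      simp only
      rw [mul_div_cancel_left₀ _ hs.ne', Real.exp_log (by positivity)]
      field_simp
  calc (1 : ENNReal) = gammaMeasure (s ^ 2) (1 / 2) Set.univ := measure_univ.symm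
    _ ≤ _ := (measure_mono h).trans (measure_union_le _ _)
    _ = _ := by rw [gammaMeasure_Iic_zero, zero_add]

lemma integrable_exp_neg_sq_div_two : Integrable fun y : ℝ ↦ Real.exp (-(y ^ 2 / 2)) := by
  convert integrable_exp_neg_mul_sq (one_half_pos (α := ℝ)) using 3
  ring

lemma stdNormalCDF_eq (x : ℝ) :
    stdNormalCDF x = (√(2 * Real.pi))⁻¹ * ∫ y in Set.Iic x, Real.exp (-(y ^ 2 / 2)) := by
  rw [stdNormalCDF, gaussianReal_apply_eq_integral _ one_ne_zero, ENNReal.toReal_ofReal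
    (integral_nonneg (gaussianPDFReal_nonneg _ _)), ← integral_const_mul]
  congr 1 with y
  simp [gaussianPDFReal, neg_div]

lemma integral_exp_neg_sq_div_two :
    (√(2 * Real.pi))⁻¹ * ∫ y : ℝ, Real.exp (-(y ^ 2 / 2)) = 1 := by
  rw [← integral_gaussianPDFReal_eq_one 0 one_ne_zero, ← integral_const_mul]
  congr 1 with y
  simp [gaussianPDFReal, neg_div]

lemma integrable_logGammaKernel {s : ℝ} (hs : 1 / 2 ≤ s) : Integrable (logGammaKernel s) := by
  have h : Integrable fun y ↦ logGammaKernel s y - Real.exp (-(y ^ 2 / 2)) :=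
    (integrable_inv_one_add_sq.const_mul (24 ^ 3 / s)).mono'
      ((continuous_logGammaKernel s).sub (by fun_prop)).aestronglyMeasurable
      (ae_of_all _ (abs_logGammaKernel_sub_le hs))
  exact (h.add integrable_exp_neg_sq_div_two).congr (ae_of_all _ fun y ↦ sub_add_cancel _ _)

lemma toReal_setLIntegral_logGammaKernel {s : ℝ} (hs : 1 / 2 ≤ s) (S : Set ℝ) :
    (∫⁻ y in S, ENNReal.ofReal (logGammaConst s * logGammaKernel s y)).toReal
      = logGammaConst s * ∫ y in S, logGammaKernel s y := by
  rw [← integral_const_mul, integral_eq_lintegral_of_nonneg_ae]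
  · exact ae_of_all _ fun y ↦ mul_nonneg (logGammaConst_nonneg (by linarith)) (Real.exp_pos _).le
  · exact ((continuous_logGammaKernel s).const_mul _).aestronglyMeasurable

lemma abs_gammaMeasure_log_le_sub_stdNormalCDF_le {s : ℝ} (hs : 1 / 2 ≤ s) (x : ℝ) :
    |(gammaMeasure (s ^ 2) (1 / 2) {z | s * Real.log (z / (2 * s ^ 2)) ≤ x}).toReal
        - stdNormalCDF x| ≤ 2 * (√(2 * Real.pi))⁻¹ * (24 ^ 3 / s * Real.pi) := by
  have hs0 : 0 < s := by linarith
  have hk := integrable_logGammaKernel hs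
  have h1 : logGammaConst s * ∫ y, logGammaKernel s y = 1 := by
    rw [← setIntegral_univ, ← toReal_setLIntegral_logGammaKernel hs, setLIntegral_univ,
      lintegral_logGammaKernel hs0, ENNReal.toReal_one]
  rw [gammaMeasure_log_le hs0, toReal_setLIntegral_logGammaKernel hs, stdNormalCDF_eq]
  refine (abs_normalized_setIntegral_sub_le hk integrable_exp_neg_sq_div_two
    (fun y ↦ (Real.exp_pos _).le) (by positivity) h1 integral_exp_neg_sq_div_two _).trans ?_
  gcongr
  rw [← integral_univ_inv_one_add_sq, ← integral_const_mul]
  exact integral_mono (hk.sub integrable_exp_neg_sq_div_two).abs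
    (integrable_inv_one_add_sq.const_mul _) (abs_logGammaKernel_sub_le hs)

/-- Berry–Esseen type bound for the logarithm of a chi-square random variable:
there is `c > 0` such that for every positive integer `m`, if `Z_m ~ χ²_m` then
`sup_x |P(√(m/2) log(Z_m/m) ≤ x) − Φ(x)| ≤ c/√m`. -/
theorem stmt3 :
    ∃ c : ℝ, 0 < c ∧
      ∀ m : ℕ, 0 < m →
        ∀ x : ℝ,
          |((chiSquareMeasure m)
                {z : ℝ | Real.sqrt ((m : ℝ) / 2) * Real.log (z / (m : ℝ)) ≤ x}).toReal
              - stdNormalCDF x|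
            ≤ c / Real.sqrt m := by
  refine ⟨2 * (√(2 * Real.pi))⁻¹ * (24 ^ 3 * √2 * Real.pi), by positivity, fun m hm x ↦ ?_⟩
  have hm1 : (1 : ℝ) ≤ m := by exact_mod_cast hm
  have hs : 1 / 2 ≤ √((m : ℝ) / 2) := Real.le_sqrt_of_sq_le (by linarith)
  have hsq : √((m : ℝ) / 2) ^ 2 = m / 2 := Real.sq_sqrt (by positivity)
  have h := abs_gammaMeasure_log_le_sub_stdNormalCDF_le hs x
  rw [hsq, mul_div_cancel₀ _ (two_ne_zero' ℝ)] at h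
  refine h.trans_eq ?_
  rw [Real.sqrt_div (by positivity)]
  field_simp
end
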